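/- arXiv:1603.04735 — 3 statements merged into one kernel-verified Lean document; each statement's English description precedes it below -/
import Mathlib

section
/- Let β ∈ (0,1). For 0 ≤ a < b < 1, define G(a,b) := (β/(2(b−a))) · ∫_a^b ∫_a^b ((1−u)^{(β−1)/2} − (1−v)^{(β−1)/2})² du dv. Then G(a,b) = (1−a)^β − (1−b)^β − (4β/((β+1)²(b−a))) · ((1−a)^{(β+1)/2} − (1−b)^{(β+1)/2})². -/
open MeasureTheory Real

/-- The first-chaos contribution to the mean-square hedging error on `[a,b]` for the
integrand `η(t) = √β (1-t)^((β-1)/2)` with `T = 1`. -/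
noncomputable def G (β a b : ℝ) : ℝ :=
  (β / (2 * (b - a))) *
    ∫ u in a..b, ∫ v in a..b, ((1 - u) ^ ((β - 1) / 2) - (1 - v) ^ ((β - 1) / 2)) ^ 2

theorem integral_integral_sub_sq {f : ℝ → ℝ} {a b : ℝ}
    (hf : IntervalIntegrable f volume a b)
    (hf2 : IntervalIntegrable (fun x => f x ^ 2) volume a b) :
    ∫ u in a..b, ∫ v in a..b, (f u - f v) ^ 2 =
      2 * (b - a) * (∫ x in a..b, f x ^ 2) - 2 * (∫ x in a..b, f x) ^ 2 := by
  have inner_eq (u : ℝ) : ∫ v in a..b, (f u - f v) ^ 2 =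
      (b - a) * f u ^ 2 - 2 * (∫ x in a..b, f x) * f u + ∫ x in a..b, f x ^ 2 := by
    have expand (v : ℝ) : (f u - f v) ^ 2 = f u ^ 2 - 2 * f u * f v + f v ^ 2 := by ring
    simp_rw [expand]
    rw [intervalIntegral.integral_add
        (intervalIntegrable_const.sub (hf.const_mul _)) hf2,
      intervalIntegral.integral_sub intervalIntegrable_const (hf.const_mul _),
      intervalIntegral.integral_const, intervalIntegral.integral_const_mul, smul_eq_mul]
    ring
  simp_rw [inner_eq]
  rw [intervalIntegral.integral_add
      ((hf2.const_mul _).sub (hf.const_mul _)) intervalIntegrable_const,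
    intervalIntegral.integral_sub (hf2.const_mul _) (hf.const_mul _),
    intervalIntegral.integral_const, intervalIntegral.integral_const_mul,
    intervalIntegral.integral_const_mul, smul_eq_mul]
  ring

theorem continuousOn_one_sub_rpow {a b : ℝ} (hab : a ≤ b) (hb : b < 1) (p : ℝ) :
    ContinuousOn (fun x : ℝ => (1 - x) ^ p) (Set.uIcc a b) := by
  refine (continuousOn_const.sub continuousOn_id).rpow_const fun x hx => Or.inl ?_
  rw [Set.uIcc_of_le hab] at hx
  exact sub_ne_zero.mpr (hx.2.trans_lt hb).ne'

theorem integral_one_sub_rpow {a b p : ℝ} (hp : -1 < p) :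
    ∫ x in a..b, (1 - x) ^ p = ((1 - a) ^ (p + 1) - (1 - b) ^ (p + 1)) / (p + 1) := by
  rw [intervalIntegral.integral_comp_sub_left (fun x : ℝ => x ^ p) 1, integral_rpow (Or.inl hp)]

/-- For `β ∈ (0,1)` and `0 ≤ a < b < 1`:
`G(a,b) = (1-a)^β - (1-b)^β - (4β/((β+1)²(b-a)))((1-a)^((β+1)/2) - (1-b)^((β+1)/2))²`. -/
theorem G_closed_form (β a b : ℝ) (hβ0 : 0 < β) (hβ1 : β < 1)
    (ha : 0 ≤ a) (hab : a < b) (hb : b < 1) :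
    G β a b = (1 - a) ^ β - (1 - b) ^ β -
      (4 * β / ((β + 1) ^ 2 * (b - a))) *
        ((1 - a) ^ ((β + 1) / 2) - (1 - b) ^ ((β + 1) / 2)) ^ 2 := by
  have hcont := continuousOn_one_sub_rpow hab.le hb ((β - 1) / 2)
  have integral_sq : ∫ x in a..b, ((1 - x) ^ ((β - 1) / 2)) ^ 2 =
      ((1 - a) ^ β - (1 - b) ^ β) / β := by
    have sq_eq : Set.EqOn (fun x : ℝ => ((1 - x) ^ ((β - 1) / 2)) ^ 2)
        (fun x => (1 - x) ^ (β - 1)) (Set.uIcc a b) := by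
      intro x hx
      rw [Set.uIcc_of_le hab.le] at hx
      have h1x : 0 ≤ 1 - x := by linarith [hx.2]
      simp only
      rw [← rpow_mul_natCast h1x]
      congr 1
      push_cast
      ring
    rw [intervalIntegral.integral_congr sq_eq, integral_one_sub_rpow (by linarith),
      sub_add_cancel]
  rw [G, integral_integral_sub_sq hcont.intervalIntegrable (hcont.pow 2).intervalIntegrable,
    integral_sq, integral_one_sub_rpow (by linarith),
    show (β - 1) / 2 + 1 = (β + 1) / 2 by ring]
  have hba : b - a ≠ 0 := sub_ne_zero.mpr hab.ne'
  have hβ : β + 1 ≠ 0 := by linarith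
  field_simp
  ring
end

section
/- Let β ∈ (0,1) and 0 ≤ a < b < 1. Define G(a,b) := (β/(2(b−a))) · ∫_a^b ∫_a^b ((1−u)^{(β−1)/2} − (1−v)^{(β−1)/2})² du dv. Then 0 ≤ G(a,b) ≤ β(1−β)(1−b)^{β−2}(b−a)². -/
open MeasureTheory Real

/-- A Bernoulli-type lower bound for nonpositive exponents. -/
theorem one_add_mul_sub_one_le_rpow {t p : ℝ} (ht : 0 < t) (hp : p ≤ 0) :
    1 + p * (t - 1) ≤ t ^ p := by
  rw [rpow_def_of_pos ht]
  have h₁ := add_one_le_exp (log t * p)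
  have h₂ := mul_le_mul_of_nonpos_left (log_le_sub_one_of_pos ht) hp
  linarith

/-- Squared increments of a nonpositive power are controlled by the length of the increment. -/
theorem sq_rpow_sub_rpow_le {x y p : ℝ} (hx : 0 < x) (hxy : x ≤ y) (hp : p ≤ 0) :
    (x ^ p - y ^ p) ^ 2 ≤ -p * x ^ (2 * p - 1) * (y - x) := by
  have hy : 0 < y := hx.trans_le hxy
  have hB := one_add_mul_sub_one_le_rpow (div_pos hy hx) hp
  rw [div_rpow hy.le hx.le, le_div_iff₀ (rpow_pos_of_pos hx p)] at hB
  have h₁ : x ^ p - y ^ p ≤ -p * (y / x - 1) * x ^ p := by linarith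
  have h₂ : x ^ p - y ^ p ≤ x ^ p := by linarith [rpow_pos_of_pos hy p]
  have h₀ : 0 ≤ x ^ p - y ^ p := sub_nonneg.2 (rpow_le_rpow_of_nonpos hx hxy hp)
  have hpow : x ^ (2 * p - 1) = x ^ p * x ^ p / x := by
    rw [rpow_sub_one hx.ne', two_mul, rpow_add hx]
  calc (x ^ p - y ^ p) ^ 2 = (x ^ p - y ^ p) * (x ^ p - y ^ p) := sq _
    _ ≤ -p * (y / x - 1) * x ^ p * x ^ p := mul_le_mul h₁ h₂ h₀ (h₀.trans h₁)
    _ = -p * x ^ (2 * p - 1) * (y - x) := by rw [hpow]; field_simp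

/-- The squared increments of a nonpositive power on an interval `[s, s + L]`. -/
theorem sq_rpow_sub_rpow_le_of_mem {s L x y p : ℝ} (hs : 0 < s) (hp : p ≤ 0)
    (hx : x ∈ Set.Icc s (s + L)) (hy : y ∈ Set.Icc s (s + L)) :
    (x ^ p - y ^ p) ^ 2 ≤ -p * s ^ (2 * p - 1) * L := by
  wlog hxy : x ≤ y generalizing x y
  · rw [sub_sq_comm]
    exact this hy hx (le_of_not_ge hxy)
  refine (sq_rpow_sub_rpow_le (hs.trans_le hx.1) hxy hp).trans ?_
  have hpow : x ^ (2 * p - 1) ≤ s ^ (2 * p - 1) :=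
    rpow_le_rpow_of_nonpos hs hx.1 (by linarith)
  have hp' : 0 ≤ -p := neg_nonneg.2 hp
  have hL : y - x ≤ L := by linarith [hx.1, hy.2]
  have := sub_nonneg.2 hxy
  gcongr

/-- For `β ∈ (0,1)` and `0 ≤ a < b < 1`: `0 ≤ G(a,b) ≤ β(1-β)(1-b)^(β-2)(b-a)²`. -/
theorem G_bounds (β a b : ℝ) (hβ0 : 0 < β) (hβ1 : β < 1)
    (ha : 0 ≤ a) (hab : a < b) (hb : b < 1) :
    0 ≤ G β a b ∧ G β a b ≤ β * (1 - β) * (1 - b) ^ (β - 2) * (b - a) ^ 2 := by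
  have hL : 0 < b - a := sub_pos.2 hab
  have hs : 0 < 1 - b := sub_pos.2 hb
  have hmem : ∀ u ∈ Set.uIoc a b, 1 - u ∈ Set.Icc (1 - b) (1 - b + (b - a)) := by
    intro u hu
    rw [Set.uIoc_of_le hab.le] at hu
    constructor <;> linarith [hu.1, hu.2]
  refine ⟨mul_nonneg (by positivity) ?_, ?_⟩
  · exact intervalIntegral.integral_nonneg hab.le fun u _ =>
      intervalIntegral.integral_nonneg hab.le fun v _ => sq_nonneg _
  set K : ℝ := -((β - 1) / 2) * (1 - b) ^ (2 * ((β - 1) / 2) - 1) * (b - a) with hK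
  have hI : ‖∫ u in a..b, ∫ v in a..b,
      ((1 - u) ^ ((β - 1) / 2) - (1 - v) ^ ((β - 1) / 2)) ^ 2‖ ≤ K * |b - a| * |b - a| := by
    refine intervalIntegral.norm_integral_le_of_norm_le_const fun u hu =>
      intervalIntegral.norm_integral_le_of_norm_le_const fun v hv => ?_
    rw [Real.norm_of_nonneg (sq_nonneg _)]
    exact sq_rpow_sub_rpow_le_of_mem hs (by linarith) (hmem u hu) (hmem v hv)
  rw [abs_of_pos hL] at hI
  have hexp : 2 * ((β - 1) / 2) - 1 = β - 2 := by ring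
  rw [hexp] at hK
  have hpos : 0 ≤ β * (1 - β) * (1 - b) ^ (β - 2) * (b - a) ^ 2 := by
    have := sub_pos.2 hβ1
    positivity
  calc G β a b ≤ β / (2 * (b - a)) * (K * (b - a) * (b - a)) :=
        mul_le_mul_of_nonneg_left ((Real.le_norm_self _).trans hI) (by positivity)
    _ = β * (1 - β) * (1 - b) ^ (β - 2) * (b - a) ^ 2 / 4 := by rw [hK]; field_simp; ring
    _ ≤ _ := by linarith
end

section
/- Let β ∈ (0,1) and θ ∈ (0,1). There exists a constant c = c(β,θ) > 0 such that for every integer m ≥ 1, max_{1 ≤ i ≤ m} [ (1 − (i−1)/m)^β − (1 − i/m)^β ] / (1 − (i−1)/m)^{β(1−θ)} ≤ c · m^{−βθ}. -/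
open Real Finset

/-- The increment of `x ↦ x ^ β` over a step `h` ending at `y + h`, relative to
`(y + h) ^ (β (1 - θ))`, is at most `h ^ (β θ)`. -/
lemma rpow_increment_div_le {β θ y h : ℝ} (hβ0 : 0 ≤ β) (hβ1 : β ≤ 1) (hθ1 : θ ≤ 1)
    (hy : 0 ≤ y) (hh : 0 < h) :
    ((y + h) ^ β - y ^ β) / (y + h) ^ (β * (1 - θ)) ≤ h ^ (β * θ) := by
  have hsub : (y + h) ^ β ≤ y ^ β + h ^ β := Real.rpow_add_le_add_rpow hy hh.le hβ0 hβ1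
  have hden : h ^ (β * (1 - θ)) ≤ (y + h) ^ (β * (1 - θ)) :=
    Real.rpow_le_rpow hh.le (by linarith) (mul_nonneg hβ0 (by linarith))
  rw [div_le_iff₀ (Real.rpow_pos_of_pos (by linarith) _)]
  calc (y + h) ^ β - y ^ β ≤ h ^ β := by linarith
    _ = h ^ (β * θ) * h ^ (β * (1 - θ)) := by
      rw [← Real.rpow_add hh]
      ring_nf
    _ ≤ h ^ (β * θ) * (y + h) ^ (β * (1 - θ)) := by gcongr

/-- For `β, θ ∈ (0,1)` there is `c = c(β,θ) > 0` such that for every `m ≥ 1`,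
`max_{1 ≤ i ≤ m} [(1-(i-1)/m)^β - (1-i/m)^β] / (1-(i-1)/m)^(β(1-θ)) ≤ c·m^(-βθ)`. -/
theorem transformed_net_adaptedness (β θ : ℝ) (hβ0 : 0 < β) (hβ1 : β < 1)
    (hθ0 : 0 < θ) (hθ1 : θ < 1) :
    ∃ c : ℝ, 0 < c ∧ ∀ m : ℕ, 1 ≤ m → ∀ i : ℕ, 1 ≤ i → i ≤ m →
      ((1 - ((i : ℝ) - 1) / m) ^ β - (1 - (i : ℝ) / m) ^ β) /
          (1 - ((i : ℝ) - 1) / m) ^ (β * (1 - θ))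
        ≤ c * (m : ℝ) ^ (-(β * θ)) := by
  refine ⟨1, one_pos, fun m hm i _ him => ?_⟩
  have hm0 : (0 : ℝ) < m := by exact_mod_cast hm
  have hy : 0 ≤ 1 - (i : ℝ) / m :=
    sub_nonneg.2 ((div_le_one hm0).2 (by exact_mod_cast him))
  have hx : 1 - ((i : ℝ) - 1) / m = (1 - (i : ℝ) / m) + (m : ℝ)⁻¹ := by
    field_simp
    ring
  rw [hx, one_mul, Real.rpow_neg hm0.le, ← Real.inv_rpow hm0.le]
  exact rpow_increment_div_le hβ0.le hβ1.le hθ1.le hy (inv_pos.2 hm0)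
end
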